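/- Let δ > 0 and let f : ℝ³ → ℝ be a smooth compactly supported function. Suppose E > 0 satisfies ∫_{ℝ³} ( f(x)²/|x|² + |∇f(x)|² ) dx ≤ E and ∫_{|x| ≥ δ} (Δf(x))² dx ≤ E. Then there exists a constant C > 0, depending only on δ (and not on f or E), such that sup_{|x| ≥ 2δ} |f(x)|² ≤ C E. -/

import Mathlib

open MeasureTheory Real

noncomputable section

/-- The standard basis directions of `ℝ³`. -/
noncomputable def e3 (i : Fin 3) : EuclideanSpace ℝ (Fin 3) := EuclideanSpace.single i 1

/-- Euclidean Laplacian on `ℝ³`: `Δf = ∑ i ∂²f/∂xᵢ²`. -/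
noncomputable def lapE (f : EuclideanSpace ℝ (Fin 3) → ℝ) (x : EuclideanSpace ℝ (Fin 3)) : ℝ :=
  ∑ i : Fin 3, fderiv ℝ (fun y => fderiv ℝ f y (e3 i)) x (e3 i)

/-- Squared Euclidean gradient on `ℝ³`: `|∇f|² = ∑ i (∂f/∂xᵢ)²`. -/
noncomputable def gradSqE (f : EuclideanSpace ℝ (Fin 3) → ℝ) (x : EuclideanSpace ℝ (Fin 3)) : ℝ :=
  ∑ i : Fin 3, (fderiv ℝ f x (e3 i)) ^ 2


open scoped SchwartzMap FourierTransform LineDeriv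

lemma radial_integrable :
    Integrable (fun ξ : EuclideanSpace ℝ (Fin 3) => (‖ξ‖ ^ 2 + ‖ξ‖ ^ 4)⁻¹) := by
  have := (integrable_fun_norm_addHaar (volume : Measure (EuclideanSpace ℝ (Fin 3)))
    (f := fun r : ℝ => (r ^ 2 + r ^ 4)⁻¹))
  rw [this]
  have h2 : IntegrableOn (fun r : ℝ => (1 + r ^ 2)⁻¹) (Set.Ioi 0) :=
    integrable_inv_one_add_sq.integrableOn
  refine h2.congr_fun ?_ measurableSet_Ioi
  intro r hr
  have hr : 0 < r := hr
  simp only [finrank_euclideanSpace, Fintype.card_fin, smul_eq_mul]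
  norm_num
  field_simp

lemma sobolev_sup : ∃ K : ℝ, 0 < K ∧ ∀ g : EuclideanSpace ℝ (Fin 3) → ℝ,
    ContDiff ℝ (⊤ : ℕ∞) g → HasCompactSupport g →
    ∀ x, |g x| ^ 2 ≤ K * (∫ y, (gradSqE g y + lapE g y ^ 2)) := by
  set A : ℝ := ∫ ξ : EuclideanSpace ℝ (Fin 3), (‖ξ‖ ^ 2 + ‖ξ‖ ^ 4)⁻¹ with hA
  have hA0 : 0 ≤ A := integral_nonneg fun ξ => by positivity
  refine ⟨A + 1, by positivity, ?_⟩
  intro g hg hgc x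
  have hGc : HasCompactSupport (fun y => (g y : ℂ)) := hgc.comp_left (g := fun t : ℝ => (t : ℂ)) (by simp)
  have hGs : ContDiff ℝ (⊤ : ℕ∞) (fun y => (g y : ℂ)) := Complex.ofRealCLM.contDiff.comp hg
  let G : 𝓢(EuclideanSpace ℝ (Fin 3), ℂ) := hGc.toSchwartzMap hGs
  have hG : ∀ y, G y = (g y : ℂ) := fun y => rfl
  have hD : ∀ i y, (∂_{e3 i} G) y = ((fderiv ℝ g y (e3 i) : ℝ) : ℂ) := by
    intro i y
    rw [SchwartzMap.lineDerivOp_apply_eq_fderiv]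
    have h1 : HasFDerivAt g (fderiv ℝ g y) y := (hg.differentiable (by simp) y).hasFDerivAt
    have h2 : HasFDerivAt (G : EuclideanSpace ℝ (Fin 3) → ℂ) (Complex.ofRealCLM.comp (fderiv ℝ g y)) y :=
      Complex.ofRealCLM.hasFDerivAt.comp y h1
    rw [h2.fderiv]; rfl
  have hDs : ∀ i, ContDiff ℝ (⊤ : ℕ∞) (fun y => fderiv ℝ g y (e3 i)) := fun i =>
    (hg.fderiv_right (m := (⊤ : ℕ∞)) (by simp)).clm_apply contDiff_const
  have hDD : ∀ i y, (∂_{e3 i} (∂_{e3 i} G)) y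
      = ((fderiv ℝ (fun y => fderiv ℝ g y (e3 i)) y (e3 i) : ℝ) : ℂ) := by
    intro i y
    rw [SchwartzMap.lineDerivOp_apply_eq_fderiv]
    have h1 : HasFDerivAt (fun y => fderiv ℝ g y (e3 i)) _ y :=
      ((hDs i).differentiable (by simp) y).hasFDerivAt
    have h2 : HasFDerivAt ((∂_{e3 i} G : 𝓢(EuclideanSpace ℝ (Fin 3), ℂ)) : EuclideanSpace ℝ (Fin 3) → ℂ)
        (Complex.ofRealCLM.comp (fderiv ℝ (fun y => fderiv ℝ g y (e3 i)) y)) y := by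
      have := Complex.ofRealCLM.hasFDerivAt.comp y h1
      refine this.congr_of_eventuallyEq (Filter.Eventually.of_forall fun z => ?_)
      exact hD i z
    rw [h2.fderiv]; rfl
  let L : 𝓢(EuclideanSpace ℝ (Fin 3), ℂ) := ∑ i, ∂_{e3 i} (∂_{e3 i} G)
  have hL : ∀ y, L y = (lapE g y : ℂ) := by
    intro y
    simp only [L, lapE, sum_apply, hDD]
    push_cast; rfl
  have hFD : ∀ (H : 𝓢(EuclideanSpace ℝ (Fin 3), ℂ)) i ξ,
      (𝓕 (∂_{e3 i} H)) ξ = (2 * π * Complex.I) * (ξ i : ℂ) * (𝓕 H) ξ := by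
    intro H i ξ
    have : (fun x : EuclideanSpace ℝ (Fin 3) => inner ℝ x (e3 i)).HasTemperateGrowth := by fun_prop
    rw [SchwartzMap.fourier_lineDerivOp_eq]
    rw [smul_apply, SchwartzMap.smulLeftCLM_apply_apply this]
    simp [e3, EuclideanSpace.inner_single_right, mul_assoc]
  have hnorm : ∀ ξ : EuclideanSpace ℝ (Fin 3), ‖ξ‖ ^ 2 = ∑ i, ξ i ^ 2 := fun ξ => by
    rw [EuclideanSpace.norm_sq_eq]; simp
  have hFL : ∀ ξ, (𝓕 L) ξ = -(((2 * π) ^ 2 * ‖ξ‖ ^ 2 : ℝ) : ℂ) * (𝓕 G) ξ := by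
    intro ξ
    have : 𝓕 L = ∑ i, 𝓕 (∂_{e3 i} (∂_{e3 i} G)) := by
      simp only [L]
      exact map_sum (FourierTransform.fourierCLM ℂ 𝓢(EuclideanSpace ℝ (Fin 3), ℂ)) _ _
    rw [this, sum_apply]
    simp only [hFD, hnorm, Fin.sum_univ_three]
    push_cast
    linear_combination ((2*π)^2 * ((ξ 0:ℂ)^2+(ξ 1:ℂ)^2+(ξ 2:ℂ)^2) * (𝓕 G) ξ) * Complex.I_sq
  have hint : ∀ H : 𝓢(EuclideanSpace ℝ (Fin 3), ℂ), Integrable (fun y => ‖H y‖ ^ 2) := fun H =>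
    (H.memLp 2 volume).integrable_norm_pow (by norm_num)
  have hB : (∫ y, (gradSqE g y + lapE g y ^ 2))
      = ∫ ξ, ((∑ i, ‖(𝓕 (∂_{e3 i} G)) ξ‖ ^ 2) + ‖(𝓕 L) ξ‖ ^ 2) := by
    rw [integral_add (integrable_finsetSum _ fun i _ => hint _) (hint _),
      integral_finsetSum _ (fun i _ => hint _)]
    simp only [SchwartzMap.integral_norm_sq_fourier]
    rw [← integral_finsetSum _ (fun i _ => hint _),
      ← integral_add (integrable_finsetSum _ fun i _ => hint _) (hint _)]
    congr 1
    ext y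
    simp [hD, hL, gradSqE]
  have hBint : Integrable fun ξ => ((∑ i, ‖(𝓕 (∂_{e3 i} G)) ξ‖ ^ 2) + ‖(𝓕 L) ξ‖ ^ 2) :=
    (integrable_finsetSum _ fun i _ => hint _).add (hint _)
  have hpt : ∀ ξ, (‖ξ‖ ^ 2 + ‖ξ‖ ^ 4) * ‖(𝓕 G) ξ‖ ^ 2 ≤
      ((∑ i, ‖(𝓕 (∂_{e3 i} G)) ξ‖ ^ 2) + ‖(𝓕 L) ξ‖ ^ 2) := by
    intro ξ
    have e1 : (∑ i, ‖(𝓕 (∂_{e3 i} G)) ξ‖ ^ 2) = (2*π)^2 * ‖ξ‖ ^ 2 * ‖(𝓕 G) ξ‖ ^ 2 := by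
      simp only [hFD, hnorm, Fin.sum_univ_three, norm_mul, mul_pow]
      simp
      ring
    have e2 : ‖(𝓕 L) ξ‖ ^ 2 = (2*π)^4 * ‖ξ‖ ^ 4 * ‖(𝓕 G) ξ‖ ^ 2 := by
      rw [hFL, norm_mul, norm_neg, Complex.norm_real, mul_pow, Real.norm_eq_abs, sq_abs]; ring
    rw [e1, e2]
    have hp : 1 ≤ 2 * π := by linarith [Real.pi_gt_three]
    have h2 : 1 ≤ (2*π)^2 := one_le_pow₀ hp
    have h4 : 1 ≤ (2*π)^4 := one_le_pow₀ hp
    have a1 : 0 ≤ ‖ξ‖ ^ 2 * ‖(𝓕 G) ξ‖ ^ 2 := by positivity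
    have a2 : 0 ≤ ‖ξ‖ ^ 4 * ‖(𝓕 G) ξ‖ ^ 2 := by positivity
    nlinarith
  set B := ∫ y, (gradSqE g y + lapE g y ^ 2) with hBdef
  set I := ∫ ξ, ‖(𝓕 G) ξ‖ with hI
  have hIint : Integrable fun ξ => ‖(𝓕 G) ξ‖ := (SchwartzMap.integrable (𝓕 G)).norm
  have hI0 : 0 ≤ I := integral_nonneg fun _ => norm_nonneg _
  have key : ∀ t : ℝ, 2 * t * I ≤ t ^ 2 * A + B := by
    intro t
    rw [hI, hA, hB, ← integral_const_mul, ← integral_const_mul,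
      ← integral_add (radial_integrable.const_mul _) hBint]
    refine integral_mono_ae (hIint.const_mul _) ((radial_integrable.const_mul _).add hBint) ?_
    have hne : ∀ᵐ ξ : EuclideanSpace ℝ (Fin 3), ξ ≠ 0 := Measure.ae_ne volume 0
    filter_upwards [hne] with ξ hξ
    refine le_trans ?_ (add_le_add_right (hpt ξ) _)
    have hw : 0 < ‖ξ‖ ^ 2 + ‖ξ‖ ^ 4 := by
      have := norm_pos_iff.mpr hξ
      positivity
    set w := ‖ξ‖ ^ 2 + ‖ξ‖ ^ 4
    set a := ‖(𝓕 G) ξ‖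
    have : 0 ≤ w⁻¹ * (t - w * a) ^ 2 := by positivity
    have e : w⁻¹ * (t - w * a) ^ 2 = t^2 * w⁻¹ + w * a^2 - 2 * t * a := by
      field_simp
      ring
    linarith
  have hIB : I ^ 2 ≤ (A + 1) * B := by
    have := key (I / (A + 1))
    have hA1 : 0 < A + 1 := by positivity
    have h1 : (I / (A+1))^2 * A ≤ (I / (A+1))^2 * (A + 1) := by gcongr; linarith
    have h2 : (I / (A+1))^2 * (A + 1) = I^2 / (A+1) := by field_simp
    have h3 : 2 * (I / (A+1)) * I = 2 * (I ^ 2 / (A+1)) := by field_simp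
    have h4 : I^2/(A+1) ≤ B := by linarith
    rw [div_le_iff₀ hA1] at h4
    linarith
  have hgI : |g x| ≤ I := by
    have h1 : 𝓕⁻ (𝓕 G) = G := FourierTransform.fourierInv_fourier_eq G
    have h2 : (g x : ℂ) = 𝓕⁻ (𝓕 G) x := by rw [h1]; rfl
    have h3 : |g x| = ‖𝓕⁻ (𝓕 G) x‖ := by rw [← h2, Complex.norm_real, Real.norm_eq_abs]
    rw [h3, SchwartzMap.fourierInv_coe, Real.fourierInv_eq]
    refine (norm_integral_le_integral_norm _).trans (le_of_eq ?_)
    simp [hI]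
  exact (pow_le_pow_left₀ (abs_nonneg _) hgI 2).trans hIB

lemma smooth_partial {f : EuclideanSpace ℝ (Fin 3) → ℝ} (hf : ContDiff ℝ (⊤ : ℕ∞) f) (i : Fin 3) :
    ContDiff ℝ (⊤ : ℕ∞) (fun y => fderiv ℝ f y (e3 i)) :=
  (hf.fderiv_right (m := (⊤ : ℕ∞)) (by simp)).clm_apply contDiff_const

lemma gradSqE_nonneg (f : EuclideanSpace ℝ (Fin 3) → ℝ) (x : EuclideanSpace ℝ (Fin 3)) :
    0 ≤ gradSqE f x := by
  unfold gradSqE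
  positivity

lemma gradSqE_continuous {f : EuclideanSpace ℝ (Fin 3) → ℝ} (hf : ContDiff ℝ (⊤ : ℕ∞) f) :
    Continuous (gradSqE f) :=
  continuous_finsetSum _ fun i _ => (smooth_partial hf i).continuous.pow 2

lemma lapE_continuous {f : EuclideanSpace ℝ (Fin 3) → ℝ} (hf : ContDiff ℝ (⊤ : ℕ∞) f) :
    Continuous (lapE f) :=
  continuous_finsetSum _ fun i _ => (smooth_partial (smooth_partial hf i) i).continuous

lemma gradSqE_compact {f : EuclideanSpace ℝ (Fin 3) → ℝ} (hf : HasCompactSupport f) :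
    HasCompactSupport (gradSqE f) := by
  have h : ∀ i, HasCompactSupport (fun x => (fderiv ℝ f x (e3 i)) ^ 2) := fun i =>
    (hf.fderiv_apply ℝ (e3 i)).comp_left (g := fun t : ℝ => t ^ 2) (by simp)
  have e : gradSqE f = (fun x => (fderiv ℝ f x (e3 0)) ^ 2) + (fun x => (fderiv ℝ f x (e3 1)) ^ 2)
      + (fun x => (fderiv ℝ f x (e3 2)) ^ 2) := by
    ext x; simp [gradSqE, Fin.sum_univ_three]
  rw [e]
  exact ((h 0).add (h 1)).add (h 2)

lemma lapE_compact {f : EuclideanSpace ℝ (Fin 3) → ℝ} (hf : HasCompactSupport f) :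
    HasCompactSupport (lapE f) := by
  have h : ∀ i, HasCompactSupport (fun x => fderiv ℝ (fun y => fderiv ℝ f y (e3 i)) x (e3 i)) :=
    fun i => (hf.fderiv_apply ℝ (e3 i)).fderiv_apply ℝ (e3 i)
  have e : lapE f = (fun x => fderiv ℝ (fun y => fderiv ℝ f y (e3 0)) x (e3 0))
      + (fun x => fderiv ℝ (fun y => fderiv ℝ f y (e3 1)) x (e3 1))
      + (fun x => fderiv ℝ (fun y => fderiv ℝ f y (e3 2)) x (e3 2)) := by
    ext x; simp [lapE, Fin.sum_univ_three]
  rw [e]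
  exact ((h 0).add (h 1)).add (h 2)

lemma hardy_integrable {f : EuclideanSpace ℝ (Fin 3) → ℝ} (hf : ContDiff ℝ (⊤ : ℕ∞) f)
    (hfc : HasCompactSupport f) : Integrable (fun x => (f x) ^ 2 / ‖x‖ ^ 2) := by
  have hc : Continuous (fun x => (f x) ^ 2 * (1 + ‖x‖ ^ 2)) := by
    have := hf.continuous
    fun_prop
  have hs : HasCompactSupport (fun x => (f x) ^ 2 * (1 + ‖x‖ ^ 2)) :=
    HasCompactSupport.mul_right (f := fun x => (f x) ^ 2)
      (hfc.comp_left (g := fun t : ℝ => t ^ 2) (by simp))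
  obtain ⟨M, hM⟩ := hs.exists_bound_of_continuous hc
  have := radial_integrable.bdd_mul hc.aestronglyMeasurable (Filter.Eventually.of_forall hM)
  refine this.congr (Filter.Eventually.of_forall fun x => ?_)
  simp only
  rcases eq_or_ne x 0 with rfl | hx
  · simp
  · have : 0 < ‖x‖ := norm_pos_iff.mpr hx
    field_simp

lemma partial_mul {u f : EuclideanSpace ℝ (Fin 3) → ℝ} (hu : ContDiff ℝ (⊤ : ℕ∞) u)
    (hf : ContDiff ℝ (⊤ : ℕ∞) f) (v x : EuclideanSpace ℝ (Fin 3)) :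
    fderiv ℝ (fun y => u y * f y) x v = u x * fderiv ℝ f x v + f x * fderiv ℝ u x v := by
  rw [fderiv_fun_mul (hu.differentiable (by simp) x) (hf.differentiable (by simp) x)]
  simp

lemma lapE_mul {u f : EuclideanSpace ℝ (Fin 3) → ℝ} (hu : ContDiff ℝ (⊤ : ℕ∞) u)
    (hf : ContDiff ℝ (⊤ : ℕ∞) f) (x : EuclideanSpace ℝ (Fin 3)) :
    lapE (fun y => u y * f y) x = u x * lapE f x + f x * lapE u x
      + 2 * ∑ i, fderiv ℝ u x (e3 i) * fderiv ℝ f x (e3 i) := by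
  have h : ∀ i, fderiv ℝ (fun y => fderiv ℝ (fun y => u y * f y) y (e3 i)) x (e3 i)
      = u x * fderiv ℝ (fun y => fderiv ℝ f y (e3 i)) x (e3 i)
        + f x * fderiv ℝ (fun y => fderiv ℝ u y (e3 i)) x (e3 i)
        + 2 * (fderiv ℝ u x (e3 i) * fderiv ℝ f x (e3 i)) := by
    intro i
    simp only [partial_mul hu hf]
    rw [fderiv_fun_add ((hu.mul (smooth_partial hf i)).differentiable (by simp) x)
      ((hf.mul (smooth_partial hu i)).differentiable (by simp) x), add_apply,
      partial_mul hu (smooth_partial hf i), partial_mul hf (smooth_partial hu i)]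
    ring
  simp only [lapE, h, Fin.sum_univ_three]
  ring

lemma gradSqE_mul_le {u f : EuclideanSpace ℝ (Fin 3) → ℝ} (hu : ContDiff ℝ (⊤ : ℕ∞) u)
    (hf : ContDiff ℝ (⊤ : ℕ∞) f) (x : EuclideanSpace ℝ (Fin 3)) :
    gradSqE (fun y => u y * f y) x ≤ 2 * (u x ^ 2 * gradSqE f x) + 2 * (f x ^ 2 * gradSqE u x) := by
  simp only [gradSqE, partial_mul hu hf, Finset.mul_sum, ← Finset.sum_add_distrib]
  refine Finset.sum_le_sum fun i _ => ?_
  nlinarith [sq_nonneg (u x * fderiv ℝ f x (e3 i) - f x * fderiv ℝ u x (e3 i))]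

lemma lapE_mul_sq_le {u f : EuclideanSpace ℝ (Fin 3) → ℝ} (hu : ContDiff ℝ (⊤ : ℕ∞) u)
    (hf : ContDiff ℝ (⊤ : ℕ∞) f) (x : EuclideanSpace ℝ (Fin 3)) :
    lapE (fun y => u y * f y) x ^ 2 ≤ 3 * (u x ^ 2 * lapE f x ^ 2) + 3 * (f x ^ 2 * lapE u x ^ 2)
      + 12 * (gradSqE u x * gradSqE f x) := by
  rw [lapE_mul hu hf]
  have cs : (∑ i, fderiv ℝ u x (e3 i) * fderiv ℝ f x (e3 i)) ^ 2 ≤ gradSqE u x * gradSqE f x :=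
    Finset.sum_mul_sq_le_sq_mul_sq _ _ _
  set s := ∑ i, fderiv ℝ u x (e3 i) * fderiv ℝ f x (e3 i)
  set a := u x * lapE f x with ha
  set b := f x * lapE u x with hb
  have e1 : u x ^ 2 * lapE f x ^ 2 = a ^ 2 := by rw [ha]; ring
  have e2 : f x ^ 2 * lapE u x ^ 2 = b ^ 2 := by rw [hb]; ring
  rw [e1, e2]
  nlinarith [sq_nonneg (a - b), sq_nonneg (a - 2 * s), sq_nonneg (b - 2 * s)]

lemma compact_mul {a c : EuclideanSpace ℝ (Fin 3) → ℝ} (ha : HasCompactSupport a) :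
    HasCompactSupport (fun x => a x * c x) :=
  HasCompactSupport.mul_right (f := a) (f' := c) ha

lemma compact_mul' {a c : EuclideanSpace ℝ (Fin 3) → ℝ} (ha : HasCompactSupport a) :
    HasCompactSupport (fun x => c x * a x) :=
  HasCompactSupport.mul_left (f := c) (f' := a) ha

lemma bdd_aux {a c : EuclideanSpace ℝ (Fin 3) → ℝ} (ha : HasCompactSupport a) (ha' : Continuous a)
    (hc : Continuous c) : ∃ M, ∀ x, a x * c x ≤ M := by
  obtain ⟨M, hM⟩ := (compact_mul (c := c) ha).exists_bound_of_continuous (ha'.mul hc)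
  exact ⟨M, fun x => (le_abs_self _).trans (hM x)⟩

lemma lapE_sq_integrable {f : EuclideanSpace ℝ (Fin 3) → ℝ} (hf : ContDiff ℝ (⊤ : ℕ∞) f)
    (hfc : HasCompactSupport f) : Integrable (fun x => lapE f x ^ 2) := by
  have h : Continuous (fun x => lapE f x * lapE f x) := (lapE_continuous hf).mul (lapE_continuous hf)
  have h2 : HasCompactSupport (fun x => lapE f x * lapE f x) := compact_mul (lapE_compact hfc)
  simp only [pow_two]
  exact h.integrable_of_hasCompactSupport h2

lemma gradSqE_integrable {f : EuclideanSpace ℝ (Fin 3) → ℝ} (hf : ContDiff ℝ (⊤ : ℕ∞) f)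
    (hfc : HasCompactSupport f) : Integrable (gradSqE f) :=
  (gradSqE_continuous hf).integrable_of_hasCompactSupport (gradSqE_compact hfc)

lemma exists_cutoff (δ : ℝ) (hδ : 0 < δ) :
    ∃ (u : EuclideanSpace ℝ (Fin 3) → ℝ) (M : ℝ), ContDiff ℝ (⊤ : ℕ∞) u ∧ 0 ≤ M ∧
      (∀ x, u x ^ 2 ≤ 1) ∧ (∀ x, ¬ δ ≤ ‖x‖ → u x = 0) ∧ (∀ x, 2 * δ ≤ ‖x‖ → u x = 1) ∧
      (∀ x, gradSqE u x ≤ M) ∧ (∀ x, gradSqE u x * ‖x‖ ^ 2 ≤ M) ∧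
      (∀ x, lapE u x ^ 2 * ‖x‖ ^ 2 ≤ M) := by
  obtain ⟨b, hbi, hbo⟩ : ∃ b : ContDiffBump (0 : EuclideanSpace ℝ (Fin 3)),
      b.rIn = δ ∧ b.rOut = 2 * δ := ⟨⟨δ, 2 * δ, hδ, by linarith⟩, rfl, rfl⟩
  have hb : ContDiff ℝ (⊤ : ℕ∞) (b : EuclideanSpace ℝ (Fin 3) → ℝ) := b.contDiff
  have hbc : HasCompactSupport (b : EuclideanSpace ℝ (Fin 3) → ℝ) := b.hasCompactSupport
  let u : EuclideanSpace ℝ (Fin 3) → ℝ := fun x => 1 - b x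
  have hu : ContDiff ℝ (⊤ : ℕ∞) u := contDiff_const.sub hb
  have hgu : gradSqE u = gradSqE b := by
    ext x; simp [gradSqE, u, fderiv_const_sub]
  have hlu : ∀ x, lapE u x ^ 2 = lapE b x ^ 2 := by
    intro x
    have : lapE u x = - lapE b x := by
      simp [lapE, u, fderiv_const_sub]
    rw [this]; ring
  have hu1 : ∀ x, u x ^ 2 ≤ 1 := by
    intro x
    have h0 := b.nonneg (x := x)
    have h1 := b.le_one (x := x)
    simp only [u]
    nlinarith
  have hu0 : ∀ x, ¬ δ ≤ ‖x‖ → u x = 0 := by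
    intro x hx
    have : b x = 1 := b.one_of_mem_closedBall (by
      rw [mem_closedBall_zero_iff, hbi]; exact (not_le.mp hx).le)
    simp [u, this]
  have hu2 : ∀ x, 2 * δ ≤ ‖x‖ → u x = 1 := by
    intro x hx
    have : b x = 0 := b.zero_of_le_dist (by rw [dist_zero_right, hbo]; exact hx)
    simp [u, this]
  have hgc0 : Continuous (gradSqE b) := gradSqE_continuous hb
  have hlc0 : Continuous (lapE b) := lapE_continuous hb
  obtain ⟨M1, hM1⟩ := bdd_aux (c := fun _ => 1) (gradSqE_compact hbc) hgc0 continuous_const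
  obtain ⟨M2, hM2⟩ := bdd_aux (c := fun x => ‖x‖ ^ 2) (gradSqE_compact hbc) hgc0
    (continuous_norm.pow 2)
  obtain ⟨M3, hM3⟩ := bdd_aux (c := fun x => lapE b x * ‖x‖ ^ 2) (lapE_compact hbc) hlc0
    (hlc0.mul (continuous_norm.pow 2))
  obtain ⟨M, hMM1, hMM2, hMM3⟩ : ∃ M, M1 ≤ M ∧ M2 ≤ M ∧ M3 ≤ M :=
    ⟨max M1 (max M2 M3), by simp, by simp, by simp⟩
  have hM1 : ∀ x, gradSqE b x ≤ M := fun x => by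
    have := hM1 x
    linarith
  have hM2 : ∀ x, gradSqE b x * ‖x‖ ^ 2 ≤ M := fun x => (hM2 x).trans hMM2
  have hM3 : ∀ x, lapE b x ^ 2 * ‖x‖ ^ 2 ≤ M := fun x => by
    have := hM3 x
    calc lapE b x ^ 2 * ‖x‖ ^ 2 = lapE b x * (lapE b x * ‖x‖ ^ 2) := by ring
      _ ≤ M := this.trans hMM3
  have hgn : ∀ (f : EuclideanSpace ℝ (Fin 3) → ℝ) x, 0 ≤ gradSqE f x := gradSqE_nonneg
  have hM0 : 0 ≤ M := (hgn b 0).trans (hM1 0)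
  refine ⟨u, M, hu, hM0, hu1, hu0, hu2, ?_, ?_, ?_⟩
  · intro x; rw [hgu]; exact hM1 x
  · intro x; rw [hgu]; exact hM2 x
  · intro x; rw [hlu]; exact hM3 x

theorem pointwise_bound_away_from_origin (δ : ℝ) (hδ : 0 < δ) :
    ∃ C : ℝ, 0 < C ∧
      ∀ f : EuclideanSpace ℝ (Fin 3) → ℝ,
        ContDiff ℝ (⊤ : ℕ∞) f → HasCompactSupport f →
        ∀ E : ℝ, 0 < E →
        (∫ x, ((f x) ^ 2 / ‖x‖ ^ 2 + gradSqE f x)) ≤ E →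
        (∫ x in {x : EuclideanSpace ℝ (Fin 3) | δ ≤ ‖x‖}, (lapE f x) ^ 2) ≤ E →
        ∀ x : EuclideanSpace ℝ (Fin 3), 2 * δ ≤ ‖x‖ → |f x| ^ 2 ≤ C * E := by
  obtain ⟨K, hK, hsob⟩ := sobolev_sup
  obtain ⟨u, M, hu, hM0, hu1, hu0, hu2, hM1, hM2, hM3⟩ := exists_cutoff δ hδ
  have hgn : ∀ (f : EuclideanSpace ℝ (Fin 3) → ℝ) x, 0 ≤ gradSqE f x := gradSqE_nonneg
  refine ⟨K * (17 * M + 5), by positivity, ?_⟩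
  intro f hf hfc E hE h1 h2 x hx
  have hg : ContDiff ℝ (⊤ : ℕ∞) (fun y => u y * f y) := hu.mul hf
  have hgc : HasCompactSupport (fun y => u y * f y) := compact_mul' hfc
  have hs := hsob _ hg hgc x
  simp only [hu2 x hx, one_mul] at hs
  refine hs.trans ?_
  rw [mul_assoc]
  refine mul_le_mul_of_nonneg_left ?_ hK.le
  have hS : MeasurableSet {x : EuclideanSpace ℝ (Fin 3) | δ ≤ ‖x‖} :=
    (isClosed_le continuous_const continuous_norm).measurableSet
  have i1 : Integrable (fun x => (f x) ^ 2 / ‖x‖ ^ 2 + gradSqE f x) :=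
    (hardy_integrable hf hfc).add (gradSqE_integrable hf hfc)
  have i2 : Integrable (Set.indicator {x : EuclideanSpace ℝ (Fin 3) | δ ≤ ‖x‖}
      (fun x => lapE f x ^ 2)) := (lapE_sq_integrable hf hfc).indicator hS
  rw [← integral_indicator hS] at h2
  have main : (∫ y, (gradSqE (fun y => u y * f y) y + lapE (fun y => u y * f y) y ^ 2)) ≤
      ∫ y, ((17 * M + 2) * ((f y) ^ 2 / ‖y‖ ^ 2 + gradSqE f y) +
        3 * Set.indicator {x : EuclideanSpace ℝ (Fin 3) | δ ≤ ‖x‖} (fun x => lapE f x ^ 2) y) := by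
    refine integral_mono_ae ((gradSqE_integrable hg hgc).add (lapE_sq_integrable hg hgc))
      ((i1.const_mul _).add (i2.const_mul _)) ?_
    have hne : ∀ᵐ y : EuclideanSpace ℝ (Fin 3), y ≠ 0 := Measure.ae_ne volume 0
    filter_upwards [hne] with y hy
    have hy0 : 0 < ‖y‖ := norm_pos_iff.mpr hy
    have q1 := gradSqE_mul_le hu hf y
    have q2 := lapE_mul_sq_le hu hf y
    have r1 : u y ^ 2 * gradSqE f y ≤ gradSqE f y :=
      mul_le_of_le_one_left (hgn f y) (hu1 y)
    have r2 : f y ^ 2 * gradSqE u y ≤ M * (f y ^ 2 / ‖y‖ ^ 2) := by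
      have : f y ^ 2 * gradSqE u y = (gradSqE u y * ‖y‖ ^ 2) * (f y ^ 2 / ‖y‖ ^ 2) := by
        field_simp
      rw [this]
      exact mul_le_mul_of_nonneg_right (hM2 y) (by positivity)
    have r3 : f y ^ 2 * lapE u y ^ 2 ≤ M * (f y ^ 2 / ‖y‖ ^ 2) := by
      have : f y ^ 2 * lapE u y ^ 2 = (lapE u y ^ 2 * ‖y‖ ^ 2) * (f y ^ 2 / ‖y‖ ^ 2) := by
        field_simp
      rw [this]
      exact mul_le_mul_of_nonneg_right (hM3 y) (by positivity)
    have r4 : gradSqE u y * gradSqE f y ≤ M * gradSqE f y :=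
      mul_le_mul_of_nonneg_right (hM1 y) (hgn f y)
    have r5 : u y ^ 2 * lapE f y ^ 2 ≤
        Set.indicator {x : EuclideanSpace ℝ (Fin 3) | δ ≤ ‖x‖} (fun x => lapE f x ^ 2) y := by
      by_cases hyd : δ ≤ ‖y‖
      · rw [Set.indicator_of_mem (by exact hyd)]
        exact mul_le_of_le_one_left (sq_nonneg _) (hu1 y)
      · rw [Set.indicator_of_notMem (by exact hyd), hu0 y hyd]
        simp
    have p1 : 0 ≤ f y ^ 2 / ‖y‖ ^ 2 := by positivity
    have p2 := mul_nonneg hM0 p1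
    have p3 := mul_nonneg hM0 (hgn f y)
    linarith
  refine main.trans ?_
  rw [integral_add (i1.const_mul _) (i2.const_mul _), integral_const_mul, integral_const_mul]
  have := mul_le_mul_of_nonneg_left h1 (show 0 ≤ 17 * M + 2 by positivity)
  linarith
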